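/- Let λ ≥ 1 be an integer, let G be a finite simple graph with n vertices and minimum degree δ, and let C be a longest cycle in G with C not a Hamilton cycle. If δ ≥ (n+2)/(λ+1) + λ − 2, then (λ − p̄ − 1)(δ − λ − p̄) ≥ 1, where p̄ is the length of a longest path in the subgraph of G induced by the vertices not on C. -/

import Mathlib

open SimpleGraph

/-- A cycle `C` is a longest cycle in `G` if no cycle of `G` has greater length. -/
def IsLongestCycle {V : Type*} (G : SimpleGraph V) {v : V} (C : G.Walk v v) : Prop :=
  C.IsCycle ∧ ∀ (u : V) (D : G.Walk u u), D.IsCycle → D.length ≤ C.length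

open scoped Classical in
/-- The length of a longest path in `H`, with the convention that it is `-1`
when `H` has no vertices. -/
noncomputable def pbar {W : Type*} (H : SimpleGraph W) : ℤ :=
  if Nonempty W then
    ((sSup {n : ℕ | ∃ (u v : W) (p : H.Walk u v), p.IsPath ∧ p.length = n} : ℕ) : ℤ)
  else -1

/-- The length of a longest cycle in `H`, where a single vertex counts as a cycle of
length 1 and a single edge as a cycle of length 2, with the convention that it is `0`
when `H` has no vertices. -/
noncomputable def cbar {W : Type*} (H : SimpleGraph W) : ℕ :=
  sSup {n : ℕ | (n = 1 ∧ Nonempty W) ∨ (n = 2 ∧ ∃ u v : W, H.Adj u v) ∨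
    ∃ (v : W) (c : H.Walk v v), c.IsCycle ∧ c.length = n}

/-- `G` is `k`-connected: it has at least `k+1` vertices and remains connected
after the deletion of any set of fewer than `k` vertices. -/
def IsKConnected {V : Type*} [Fintype V] (G : SimpleGraph V) (k : ℕ) : Prop :=
  k + 1 ≤ Fintype.card V ∧
    ∀ S : Finset V, S.card < k → (G.induce ((↑S : Set V)ᶜ)).Connected

/-- There is a path of length at least `k` from `x` to `y` all of whose vertices lie in `T`. -/
def HasPathOn {V : Type*} (G : SimpleGraph V) (T : Set V) (x y : V) (k : ℕ) : Prop :=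
  ∃ w : G.Walk x y, w.IsPath ∧ (∀ v ∈ w.support, v ∈ T) ∧ k ≤ w.length

namespace HasPathOn

variable {V : Type*} {G : SimpleGraph V} {T T' : Set V} {x y x' y' : V} {k k' : ℕ}

theorem single (hx : x ∈ T) : HasPathOn G T x x 0 :=
  ⟨Walk.nil, Walk.IsPath.nil, by simpa using hx, Nat.zero_le _⟩

theorem symm (h : HasPathOn G T x y k) : HasPathOn G T y x k := by
  obtain ⟨w, hw, hT, hk⟩ := h
  exact ⟨w.reverse, hw.reverse, by simpa using hT, by simpa using hk⟩

theorem mono (h : HasPathOn G T x y k) (hT : T ⊆ T') (hk : k' ≤ k) : HasPathOn G T' x y k' := by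
  obtain ⟨w, hw, hwT, hwk⟩ := h
  exact ⟨w, hw, fun v hv => hT (hwT v hv), hk.trans hwk⟩

theorem join (h : HasPathOn G T x y k) (h' : HasPathOn G T' x' y' k') (hadj : G.Adj y x')
    (hd : Disjoint T T') : HasPathOn G (T ∪ T') x y' (k + k' + 1) := by
  obtain ⟨w, hw, hT, hk⟩ := h
  obtain ⟨w', hw', hT', hk'⟩ := h'
  refine ⟨w.append (Walk.cons hadj w'), ?_, ?_, ?_⟩
  · rw [Walk.isPath_def, Walk.support_append, Walk.support_cons, List.tail_cons,
      List.nodup_append]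
    refine ⟨hw.support_nodup, hw'.support_nodup, ?_⟩
    rintro a ha b hb rfl
    exact Set.disjoint_left.1 hd (hT a ha) (hT' a hb)
  · intro v hv
    rw [Walk.support_append, Walk.support_cons, List.tail_cons, List.mem_append] at hv
    exact hv.imp (hT v) (hT' v)
  · simp only [Walk.length_append, Walk.length_cons]
    omega

theorem map {W : Type*} {H : SimpleGraph W} (e : G ↪g H) (h : HasPathOn G T x y k) :
    HasPathOn H (e '' T) (e x) (e y) k := by
  obtain ⟨w, hw, hT, hk⟩ := h
  refine ⟨w.map e.toHom, Walk.IsPath.map e.injective hw, ?_, by simpa using hk⟩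
  intro v hv
  rw [Walk.support_map, List.mem_map] at hv
  obtain ⟨a, ha, rfl⟩ := hv
  exact ⟨a, hT a ha, rfl⟩

/-- Closing up a path of length at least two by an edge gives a cycle. -/
theorem exists_isCycle (h : HasPathOn G T x y k) (hk : 2 ≤ k) (hadj : G.Adj y x) :
    ∃ (u : V) (D : G.Walk u u), D.IsCycle ∧ k + 1 ≤ D.length := by
  obtain ⟨w, hw, -, hwk⟩ := h
  refine ⟨y, Walk.cons hadj w, ?_, by simpa using hwk⟩
  refine (Walk.cons_isCycle_iff _ _).2 ⟨hw, fun hmem => ?_⟩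
  have := hw.length_eq_one_of_mem_edges (Sym2.eq_swap ▸ hmem)
  omega

theorem of_seq {c : ℕ → V} {a b : ℕ} (hab : a ≤ b)
    (hadj : ∀ i, a ≤ i → i < b → G.Adj (c i) (c (i + 1)))
    (hinj : ∀ i j, a ≤ i → i < j → j ≤ b → c i ≠ c j) :
    HasPathOn G {v | ∃ i, a ≤ i ∧ i ≤ b ∧ v = c i} (c a) (c b) (b - a) := by
  induction b, hab using Nat.le_induction with
  | base => exact (single (T := {v | ∃ i, a ≤ i ∧ i ≤ a ∧ v = c i})
      ⟨a, le_rfl, le_rfl, rfl⟩).mono subset_rfl (by omega)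
  | succ b hab ih =>
    have h := (ih (fun i hi hib => hadj i hi (by omega))
      (fun i j hi hij hj => hinj i j hi hij (by omega))).join
      (single (Set.mem_singleton (c (b + 1)))) (hadj b hab (by omega)) ?_
    · refine h.mono ?_ (by omega)
      rintro v (⟨i, hai, hib, rfl⟩ | rfl)
      · exact ⟨i, hai, by omega, rfl⟩
      · exact ⟨b + 1, by omega, le_rfl, rfl⟩
    · rw [Set.disjoint_singleton_right]
      rintro ⟨i, hai, hib, h⟩
      exact hinj i (b + 1) hai (by omega) le_rfl h.symm

end HasPathOn

/-- A spine `f 0 0, …, f p 0` together with pairwise disjoint teeth `f i 0, …, f i (q i)`. -/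
structure IsComb {W : Type*} (H : SimpleGraph W) (p : ℕ) (f : ℕ → ℕ → W) (q : ℕ → ℕ) : Prop where
  spine : ∀ i < p, H.Adj (f i 0) (f (i + 1) 0)
  tooth : ∀ i ≤ p, ∀ d < q i, H.Adj (f i d) (f i (d + 1))
  inj : ∀ i ≤ p, ∀ d ≤ q i, ∀ j ≤ p, ∀ e ≤ q j, f i d = f j e → i = j ∧ d = e

/-- The vertices of the comb path running from `f a c` down the tooth at `a`, along the spine,
and up the tooth at `b` to `f b d`. -/
def combSet {W : Type*} (f : ℕ → ℕ → W) (a c b d : ℕ) : Set W :=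
  {v | ∃ x y, v = f x y ∧ a ≤ x ∧ x ≤ b ∧ (y = 0 ∨ (x = a ∧ y ≤ c) ∨ (x = b ∧ y ≤ d))}

/-- Pairs `(j, d)` thought of as intervals of radius `d + 1` around `j`: if they are disjoint
for distinct `j` and lie in `[0, p]`, there are at most `p / 2` of them. -/
theorem two_mul_card_le_of_separated {p : ℕ} (N : Finset (ℕ × ℕ))
    (hN : ∀ z ∈ N, z.2 + 1 ≤ z.1 ∧ z.1 + z.2 + 1 ≤ p)
    (hsep : ∀ z ∈ N, ∀ z' ∈ N, z.1 < z'.1 → z.1 + z.2 + z'.2 + 2 ≤ z'.1) :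
    2 * N.card ≤ p := by
  classical
  have hr : (N.image fun z => z.1 + z.2).card = N.card := by
    refine Finset.card_image_of_injOn fun z hz z' hz' h => ?_
    have := hsep z hz z' hz'
    have := hsep z' hz' z hz
    have := hN z hz
    have := hN z' hz'
    exact Prod.ext (by omega) (by omega)
  have hl : (N.image fun z => z.1 - z.2 - 1).card = N.card := by
    refine Finset.card_image_of_injOn fun z hz z' hz' h => ?_
    have := hsep z hz z' hz'
    have := hsep z' hz' z hz
    have := hN z hz
    have := hN z' hz'
    exact Prod.ext (by omega) (by omega)
  have hd : Disjoint (N.image fun z => z.1 + z.2) (N.image fun z => z.1 - z.2 - 1) := by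
    rw [Finset.disjoint_left]
    intro t ht ht'
    obtain ⟨z, hz, rfl⟩ := Finset.mem_image.1 ht
    obtain ⟨z', hz', h⟩ := Finset.mem_image.1 ht'
    have := hsep z hz z' hz'
    have := hsep z' hz' z hz
    have := hN z hz
    have := hN z' hz'
    omega
  have hsub : (N.image fun z => z.1 + z.2) ∪ (N.image fun z => z.1 - z.2 - 1) ⊆
      Finset.range p := by
    intro t ht
    rw [Finset.mem_union, Finset.mem_image, Finset.mem_image] at ht
    rw [Finset.mem_range]
    rcases ht with ⟨z, hz, rfl⟩ | ⟨z, hz, rfl⟩ <;> have := hN z hz <;> omega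
  have := Finset.card_le_card hsub
  rw [Finset.card_union_of_disjoint hd, Finset.card_range] at this
  omega

namespace IsComb

variable {W : Type*} {H : SimpleGraph W} {p : ℕ} {f : ℕ → ℕ → W} {q : ℕ → ℕ}

theorem column (hf : IsComb H p f q) {a c : ℕ} (ha : a ≤ p) (hc : c ≤ q a) :
    HasPathOn H {v | ∃ y ≤ c, v = f a y} (f a 0) (f a c) c := by
  refine (HasPathOn.of_seq (c := f a) (Nat.zero_le c)
    (fun d _ hd => hf.tooth a ha d (by omega)) ?_).mono ?_ (by omega)
  · intro d e _ hde he h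
    have := hf.inj a ha d (by omega) a ha e (by omega) h
    omega
  · rintro v ⟨y, -, hy, rfl⟩
    exact ⟨y, hy, rfl⟩

theorem spine_path (hf : IsComb H p f q) {a b : ℕ} (hab : a ≤ b) (hb : b ≤ p) :
    HasPathOn H {v | ∃ x, a ≤ x ∧ x ≤ b ∧ v = f x 0} (f a 0) (f b 0) (b - a) := by
  refine HasPathOn.of_seq (c := fun x => f x 0) hab (fun x _ hx => hf.spine x (by omega)) ?_
  intro x y hx hxy hy h
  have := hf.inj x (by omega) 0 (Nat.zero_le _) y (by omega) 0 (Nat.zero_le _) h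
  omega

theorem path (hf : IsComb H p f q) {a b c d : ℕ} (hab : a < b) (hb : b ≤ p) (hc : c ≤ q a)
    (hd : d ≤ q b) : HasPathOn H (combSet f a c b d) (f a c) (f b d) (c + (b - a) + d) := by
  have h₁ := (hf.column (by omega) hc).symm
  have h₂ := hf.column hb hd
  rcases (show b = a + 1 ∨ a + 1 ≤ b - 1 by omega) with rfl | hab'
  · refine (h₁.join h₂ (hf.spine a (by omega)) ?_).mono ?_ (by omega)
    · rw [Set.disjoint_left]
      rintro _ ⟨y, hy, rfl⟩ ⟨y', hy', h⟩
      have := hf.inj a (by omega) y (by omega) (a + 1) hb y' (by omega) h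
      omega
    · rintro _ (⟨y, hy, rfl⟩ | ⟨y, hy, rfl⟩)
      · exact ⟨a, y, rfl, by omega⟩
      · exact ⟨a + 1, y, rfl, by omega⟩
  · have h₃ := hf.spine_path hab' (by omega)
    have hadj : H.Adj (f (b - 1) 0) (f b 0) := by
      have := hf.spine (b - 1) (by omega)
      rwa [Nat.sub_add_cancel (by omega)] at this
    refine ((h₁.join h₃ (hf.spine a (by omega)) ?_).join h₂ hadj ?_).mono ?_ (by omega)
    · rw [Set.disjoint_left]
      rintro _ ⟨y, hy, rfl⟩ ⟨x, hx, hx', h⟩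
      have := hf.inj a (by omega) y (by omega) x (by omega) 0 (by omega) h
      omega
    · rw [Set.disjoint_left]
      rintro _ (⟨y, hy, rfl⟩ | ⟨x, hx, hx', rfl⟩) ⟨y', hy', h⟩
      · have := hf.inj a (by omega) y (by omega) b hb y' (by omega) h
        omega
      · have := hf.inj x (by omega) 0 (by omega) b hb y' (by omega) h
        omega
    · rintro _ ((⟨y, hy, rfl⟩ | ⟨x, hx, hx', rfl⟩) | ⟨y, hy, rfl⟩)
      · exact ⟨a, y, rfl, by omega⟩
      · exact ⟨x, 0, rfl, by omega⟩
      · exact ⟨b, y, rfl, by omega⟩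

theorem left_path (hf : IsComb H p f q) {j d : ℕ} (hj : j ≤ p) (hd : d ≤ q j) :
    HasPathOn H (combSet f 0 0 j d) (f 0 0) (f j d) (j + d) := by
  rcases Nat.eq_zero_or_pos j with rfl | hj'
  · refine (hf.column hj hd).mono ?_ (by omega)
    rintro _ ⟨y, hy, rfl⟩
    exact ⟨0, y, rfl, by omega⟩
  · exact (hf.path hj' hj (Nat.zero_le _) hd).mono subset_rfl (by omega)

theorem right_path (hf : IsComb H p f q) {j d : ℕ} (hj : j ≤ p) (hd : d ≤ q j) :
    HasPathOn H (combSet f j d p 0) (f j d) (f p 0) (p - j + d) := by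
  rcases hj.eq_or_lt with rfl | hj'
  · refine (hf.column hj hd).symm.mono ?_ (by omega)
    rintro _ ⟨y, hy, rfl⟩
    exact ⟨j, y, rfl, by omega⟩
  · exact (hf.path hj' le_rfl hd (Nat.zero_le _)).mono subset_rfl (by omega)

theorem disjoint_left_right (hf : IsComb H p f q) {j d j' d' : ℕ} (hjj : j < j') (hj : j' ≤ p)
    (hd : d ≤ q j) (hd' : d' ≤ q j') :
    Disjoint (combSet f 0 0 j d) (combSet f j' d' p 0) := by
  rw [Set.disjoint_left]
  rintro _ ⟨x, y, rfl, hx⟩ ⟨x', y', h, hx'⟩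
  have hy : y ≤ q x := by rcases hx with ⟨_, _, _ | ⟨rfl, _⟩ | ⟨rfl, _⟩⟩ <;> omega
  have hy' : y' ≤ q x' := by rcases hx' with ⟨_, _, _ | ⟨rfl, _⟩ | ⟨rfl, _⟩⟩ <;> omega
  have := hf.inj x (by omega) y hy x' (by omega) y' hy' h
  omega

theorem notMem_combSet (hf : IsComb H p f q) {i b j d j' d' : ℕ} (hi : i ≤ p) (hb : b ≤ q i)
    (hb0 : b ≠ 0) (hj' : j' ≤ p) (hd : d ≤ q j) (hd' : d' ≤ q j')
    (h : ¬ (i = j ∧ b ≤ d)) (h' : ¬ (i = j' ∧ b ≤ d')) :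
    f i b ∉ combSet f j d j' d' := by
  rintro ⟨x, y, he, hx⟩
  have hy : y ≤ q x := by rcases hx with ⟨_, _, _ | ⟨rfl, _⟩ | ⟨rfl, _⟩⟩ <;> omega
  have := hf.inj i hi b hb x (by omega) y hy he
  omega

theorem le_of_link (hf : IsComb H p f q) (hmax : ∀ T x y k, HasPathOn H T x y k → k ≤ p)
    {j d j' d' : ℕ} (hjj : j < j') (hj : j' ≤ p) (hd : d ≤ q j) (hd' : d' ≤ q j')
    (hadj : H.Adj (f j d) (f j' d')) : j + d + d' + 1 ≤ j' := by
  have := hmax _ _ _ _ ((hf.left_path (by omega) hd).join (hf.right_path hj hd') hadj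
    (hf.disjoint_left_right hjj hj hd hd'))
  omega

theorem le_of_insert (hf : IsComb H p f q) (hmax : ∀ T x y k, HasPathOn H T x y k → k ≤ p)
    {j d j' d' : ℕ} {u : W} (hjj : j < j') (hj : j' ≤ p) (hd : d ≤ q j) (hd' : d' ≤ q j')
    (hadj : H.Adj u (f j d)) (hadj' : H.Adj u (f j' d'))
    (hu : u ∉ combSet f 0 0 j d) (hu' : u ∉ combSet f j' d' p 0) : j + d + d' + 2 ≤ j' := by
  have := hmax _ _ _ _ (((hf.left_path (by omega) hd).join
    (HasPathOn.single (Set.mem_singleton u)) hadj.symm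
    (Set.disjoint_singleton_right.2 hu)).join (hf.right_path hj hd') hadj'
    (Set.disjoint_union_left.2 ⟨hf.disjoint_left_right hjj hj hd hd',
      Set.disjoint_singleton_left.2 hu'⟩))
  omega

theorem le_of_end (hf : IsComb H p f q) (hmax : ∀ T x y k, HasPathOn H T x y k → k ≤ p)
    {j d : ℕ} {u : W} (hj : j ≤ p) (hd : d ≤ q j) (hadj : H.Adj u (f j d))
    (hu : u ∉ combSet f 0 0 j d) (hu' : u ∉ combSet f j d p 0) :
    d + 1 ≤ j ∧ j + d + 1 ≤ p := by
  have h₁ := hmax _ _ _ _ ((hf.left_path hj hd).join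
    (HasPathOn.single (Set.mem_singleton u)) hadj.symm (Set.disjoint_singleton_right.2 hu))
  have h₂ := hmax _ _ _ _ ((HasPathOn.single (Set.mem_singleton u)).join
    (hf.right_path hj hd) hadj (Set.disjoint_singleton_left.2 hu'))
  omega

theorem tooth_le (hf : IsComb H p f q) (hmax : ∀ T x y k, HasPathOn H T x y k → k ≤ p)
    {i : ℕ} (hi : i ≤ p) : q i ≤ i ∧ i + q i ≤ p := by
  have h₁ := hmax _ _ _ _ (hf.left_path hi le_rfl)
  have h₂ := hmax _ _ _ _ (hf.right_path hi le_rfl)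
  omega

/-- The end of a nontrivial tooth has few neighbours on the comb. -/
theorem two_mul_card_tip_le (hf : IsComb H p f q)
    (hmax : ∀ T x y k, HasPathOn H T x y k → k ≤ p) {i : ℕ} (hi : i ≤ p) (hq : 1 ≤ q i)
    (N : Finset (ℕ × ℕ))
    (hN : ∀ z ∈ N, z.1 ≤ p ∧ z.2 ≤ q z.1 ∧ H.Adj (f i (q i)) (f z.1 z.2)) :
    2 * N.card ≤ p := by
  have hti := hf.tooth_le hmax hi
  have hself : ∀ j d, (j, d) ∈ N → j = i → d < q i := by
    rintro j d hz rfl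
    obtain ⟨-, hd, hadj⟩ := hN _ hz
    refine lt_of_le_of_ne hd ?_
    rintro rfl
    exact H.loopless.irrefl _ hadj
  apply two_mul_card_le_of_separated
  · rintro ⟨j, d⟩ hz
    obtain ⟨hj, hd, hadj⟩ := hN _ hz
    have hs := hself _ _ hz
    dsimp only at *
    by_cases hji : j = i
    · have := hs hji
      omega
    · exact hf.le_of_end hmax hj hd hadj
        (hf.notMem_combSet hi le_rfl (by omega) hj (by omega) hd (by omega) (by omega))
        (hf.notMem_combSet hi le_rfl (by omega) le_rfl hd (by omega) (by omega) (by omega))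
  · rintro ⟨j, d⟩ hz ⟨j', d'⟩ hz' hjj
    obtain ⟨hj, hd, hadj⟩ := hN _ hz
    obtain ⟨hj', hd', hadj'⟩ := hN _ hz'
    have hs := hself _ _ hz
    have hs' := hself _ _ hz'
    dsimp only at *
    by_cases hji : j = i
    · subst hji
      have := hf.le_of_link hmax hjj hj' le_rfl hd' hadj'
      have := hs rfl
      omega
    · by_cases hji' : j' = i
      · subst hji'
        have := hf.le_of_link hmax hjj hj' hd le_rfl hadj.symm
        have := hs' rfl
        omega
      · exact hf.le_of_insert hmax hjj hj' hd hd' hadj hadj'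
          (hf.notMem_combSet hi le_rfl (by omega) hj (by omega) hd (by omega) (by omega))
          (hf.notMem_combSet hi le_rfl (by omega) le_rfl hd' (by omega) (by omega) (by omega))

open scoped Classical in
/-- A vertex of a tooth, off the spine, has few neighbours on the spine. -/
theorem two_mul_card_spine_le (hf : IsComb H p f q)
    (hmax : ∀ T x y k, HasPathOn H T x y k → k ≤ p) {i b : ℕ} (hi : i ≤ p) (hb : b ≤ q i)
    (hb0 : b ≠ 0) :
    2 * ((Finset.range (p + 1)).filter fun j => H.Adj (f i b) (f j 0)).card ≤ p := by
  rw [← Finset.card_map (Function.Embedding.sectL ℕ 0)]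
  apply two_mul_card_le_of_separated
  · rintro z hz
    obtain ⟨j, hj, rfl⟩ := Finset.mem_map.1 hz
    rw [Finset.mem_filter, Finset.mem_range] at hj
    exact hf.le_of_end hmax (j := j) (d := 0) (by omega) (Nat.zero_le _) hj.2
      (hf.notMem_combSet hi hb hb0 (by omega) (by omega) (by omega) (by omega) (by omega))
      (hf.notMem_combSet hi hb hb0 le_rfl (by omega) (by omega) (by omega) (by omega))
  · rintro z hz z' hz' hjj
    obtain ⟨j, hj, rfl⟩ := Finset.mem_map.1 hz
    obtain ⟨j', hj', rfl⟩ := Finset.mem_map.1 hz'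
    rw [Finset.mem_filter, Finset.mem_range] at hj hj'
    exact hf.le_of_insert hmax (j := j) (d := 0) (j' := j') (d' := 0) hjj (by omega)
      (Nat.zero_le _) (Nat.zero_le _) hj.2 hj'.2
      (hf.notMem_combSet hi hb hb0 (by omega) (by omega) (by omega) (by omega) (by omega))
      (hf.notMem_combSet hi hb hb0 le_rfl (by omega) (by omega) (by omega) (by omega))

theorem extend (hf : IsComb H p f q) {i : ℕ} (hi : i ≤ p) {z : W} (hz : H.Adj (f i (q i)) z)
    (hnew : ∀ j ≤ p, ∀ d ≤ q j, z ≠ f j d) :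
    IsComb H p (fun j d => if j = i ∧ d = q i + 1 then z else f j d)
      (Function.update q i (q i + 1)) where
  spine := by
    intro j hj
    rw [if_neg (by omega), if_neg (by omega)]
    exact hf.spine j hj
  tooth := by
    intro j hj d hd
    by_cases hji : j = i
    · subst hji
      rw [Function.update_self] at hd
      rw [if_neg (by omega)]
      split_ifs with h
      · rwa [show d = q j by omega]
      · exact hf.tooth j hj d (by omega)
    · rw [Function.update_of_ne hji] at hd
      rw [if_neg (by omega), if_neg (by omega)]
      exact hf.tooth j hj d hd
  inj := by
    have key : ∀ j d, d ≤ Function.update q i (q i + 1) j → ¬ (j = i ∧ d = q i + 1) →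
        d ≤ q j := by
      intro j d hd h
      by_cases hji : j = i
      · subst hji
        rw [Function.update_self] at hd
        omega
      · rwa [Function.update_of_ne hji] at hd
    intro j hj d hd j' hj' d' hd' h
    split_ifs at h with h₁ h₂ h₂
    · omega
    · exact absurd h (hnew j' hj' d' (key _ _ hd' h₂))
    · exact absurd h.symm (hnew j hj d (key _ _ hd h₁))
    · exact hf.inj j hj d (key _ _ hd h₁) j' hj' d' (key _ _ hd' h₂) h

/-- A trivial tooth can take over the upper part of another tooth. -/
theorem transfer (hf : IsComb H p f q) {i j d : ℕ} (hi : i ≤ p) (hj : j ≤ p) (hij : i ≠ j)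
    (hqi : q i = 0) (hd : d ≤ q j) (hd1 : 1 ≤ d) (hadj : H.Adj (f i 0) (f j d)) :
    IsComb H p (fun k b => if k = i ∧ b ≠ 0 then f j (d + b - 1) else f k b)
      (fun k => if k = i then q j - d + 1 else if k = j then d - 1 else q k) where
  spine := by
    intro k hk
    rw [if_neg (by omega), if_neg (by omega)]
    exact hf.spine k hk
  tooth := by
    intro k hk b hb
    split_ifs at hb with h₁ h₂
    · subst h₁
      rw [if_pos (show k = k ∧ b + 1 ≠ 0 by omega)]
      split_ifs with h
      · have := hf.tooth j hj (d + b - 1) (by omega)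
        rwa [show d + b - 1 + 1 = d + (b + 1) - 1 by omega] at this
      · obtain rfl : b = 0 := by omega
        simpa using hadj
    · rw [if_neg (by omega), if_neg (by omega)]
      exact hf.tooth k hk b (by subst h₂; omega)
    · rw [if_neg (by omega), if_neg (by omega)]
      exact hf.tooth k hk b hb
  inj := by
    intro k hk b hb k' hk' b' hb' h
    have key : ∀ k b, b ≤ (if k = i then q j - d + 1 else if k = j then d - 1 else q k) →
        ¬ (k = i ∧ b ≠ 0) → b ≤ q k ∧ (k = j → b < d) := by
      intro k b hb hn
      split_ifs at hb with h₁ h₂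
      · subst h₁
        omega
      · subst h₂
        omega
      · omega
    have key' : ∀ k b, b ≤ (if k = i then q j - d + 1 else if k = j then d - 1 else q k) →
        (k = i ∧ b ≠ 0) → b ≤ q j - d + 1 := by
      intro k b hb hn
      rwa [if_pos hn.1] at hb
    split_ifs at h with h₁ h₂ h₂
    · have := key' _ _ hb h₁
      have := key' _ _ hb' h₂
      have := hf.inj j hj _ (by omega) j hj _ (by omega) h
      omega
    · have := key' _ _ hb h₁
      have := key _ _ hb' h₂
      have := hf.inj j hj _ (by omega) k' hk' _ (by omega) h
      omega
    · have := key _ _ hb h₁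
      have := key' _ _ hb' h₂
      have := hf.inj k hk _ (by omega) j hj _ (by omega) h
      omega
    · exact hf.inj k hk b (key _ _ hb h₁).1 k' hk' b' (key _ _ hb' h₂).1 h

open scoped Classical in
/-- A comb in which every tooth end has all its neighbours on the comb, and in which a trivial
tooth is adjacent to no other tooth beyond its first vertex. -/
theorem exists_saturated (hf : IsComb H p f q)
    (hmax : ∀ T x y k, HasPathOn H T x y k → k ≤ p) :
    ∃ f q, IsComb H p f q ∧
      (∀ i ≤ p, ∀ z, H.Adj (f i (q i)) z → ∃ j ≤ p, ∃ d ≤ q j, z = f j d) ∧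
      (∀ i ≤ p, ∀ j ≤ p, ∀ d ≤ q j, q i = 0 → i ≠ j → H.Adj (f i 0) (f j d) → d ≤ 1) := by
  let Φ : (ℕ → ℕ) → ℕ := fun q => ∑ i ∈ Finset.range (p + 1), (q i + min (q i) 1)
  let P : ℕ → Prop := fun m => ∃ f q, IsComb H p f q ∧ Φ q = m
  have hbound : ∀ f q, IsComb H p f q → Φ q ≤ (p + 1) * (p + 1) := by
    intro f q hf
    refine (Finset.sum_le_card_nsmul _ _ (p + 1) fun i hi => ?_).trans (by simp)
    have := hf.tooth_le hmax (Nat.le_of_lt_succ (Finset.mem_range.1 hi))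
    omega
  obtain ⟨f, q, hf, hq⟩ : P (Nat.findGreatest P ((p + 1) * (p + 1))) :=
    Nat.findGreatest_spec (hbound f q hf) ⟨f, q, hf, rfl⟩
  have hΦ : ∀ f' q', IsComb H p f' q' → Φ q' ≤ Φ q := by
    intro f' q' hf'
    rw [hq]
    exact Nat.le_findGreatest (hbound f' q' hf') ⟨f', q', hf', rfl⟩
  refine ⟨f, q, hf, ?_, ?_⟩
  · intro i hi z hz
    by_contra! hnew
    refine (hΦ _ _ (hf.extend hi hz hnew)).not_gt (Finset.sum_lt_sum (fun j _ => ?_) ⟨i, ?_, ?_⟩)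
    · by_cases hji : j = i
      · subst hji
        rw [Function.update_self]
        omega
      · rw [Function.update_of_ne hji]
    · exact Finset.mem_range.2 (by omega)
    · rw [Function.update_self]
      omega
  · intro i hi j hj d hd hqi hij hadj
    by_contra! hd2
    refine (hΦ _ _ (hf.transfer hi hj hij hqi hd (by omega) hadj)).not_gt ?_
    have hi' : i ∈ Finset.range (p + 1) := Finset.mem_range.2 (by omega)
    have hj' : j ∈ (Finset.range (p + 1)).erase i :=
      Finset.mem_erase.2 ⟨hij.symm, Finset.mem_range.2 (by omega)⟩
    simp only [Φ]
    rw [← Finset.add_sum_erase _ _ hi', ← Finset.add_sum_erase _ _ hj',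
      ← Finset.add_sum_erase _ _ hi', ← Finset.add_sum_erase _ _ hj']
    have hrest : ∀ k ∈ ((Finset.range (p + 1)).erase i).erase j,
        (if k = i then q j - d + 1 else if k = j then d - 1 else q k) +
          min (if k = i then q j - d + 1 else if k = j then d - 1 else q k) 1 =
        q k + min (q k) 1 := by
      intro k hk
      rw [Finset.mem_erase, Finset.mem_erase] at hk
      rw [if_neg hk.2.1, if_neg hk.1]
    rw [Finset.sum_congr rfl hrest, if_pos rfl, if_neg hij.symm, if_pos rfl, hqi]
    omega

open scoped Classical in
theorem sum_degree_tip_le [Fintype W] (hf : IsComb H p f q)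
    (hmax : ∀ T x y k, HasPathOn H T x y k → k ≤ p)
    (hsat : ∀ i ≤ p, ∀ z, H.Adj (f i (q i)) z → ∃ j ≤ p, ∃ d ≤ q j, z = f j d)
    (htriv : ∀ i ≤ p, ∀ j ≤ p, ∀ d ≤ q j, q i = 0 → i ≠ j → H.Adj (f i 0) (f j d) → d ≤ 1) :
    ∑ i ∈ Finset.range (p + 1), H.degree (f i (q i)) ≤ (p + 1) * p := by
  set R := Finset.range (p + 1) with hR
  have hmem : ∀ {i}, i ∈ R ↔ i ≤ p := by
    intro i
    rw [hR, Finset.mem_range, Nat.lt_succ_iff]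
  let r : ℕ → ℕ → Prop := fun i j => 1 ≤ q j ∧ H.Adj (f j 1) (f i 0)
  have hdeg : ∀ i ∈ R, 2 * H.degree (f i (q i)) ≤
      (if 1 ≤ q i then p else 2 * p) + 2 * (R.bipartiteAbove r i).card := by
    intro i hi
    rw [hmem] at hi
    rw [← H.card_neighborFinset_eq_degree]
    split_ifs with hq
    · let N := (R ×ˢ R).filter fun z => z.2 ≤ q z.1 ∧ H.Adj (f i (q i)) (f z.1 z.2)
      have hN := hf.two_mul_card_tip_le hmax hi hq N (by
        intro z hz
        rw [Finset.mem_filter, Finset.mem_product, hmem] at hz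
        exact ⟨hz.1.1, hz.2⟩)
      have hsub : H.neighborFinset (f i (q i)) ⊆ N.image fun z => f z.1 z.2 := by
        intro z hz
        rw [mem_neighborFinset] at hz
        obtain ⟨j, hj, d, hd, rfl⟩ := hsat i hi z hz
        have := hf.tooth_le hmax hj
        refine Finset.mem_image.2 ⟨(j, d), Finset.mem_filter.2 ⟨?_, hd, hz⟩, rfl⟩
        exact Finset.mem_product.2 ⟨hmem.2 hj, hmem.2 (by dsimp only; omega)⟩
      have := (Finset.card_le_card hsub).trans Finset.card_image_le
      omega
    · have hq0 : q i = 0 := by omega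
      rw [hq0]
      have hsub : H.neighborFinset (f i 0) ⊆ ((R.erase i).image fun j => f j 0) ∪
          (R.bipartiteAbove r i).image fun j => f j 1 := by
        intro z hz
        rw [mem_neighborFinset] at hz
        obtain ⟨j, hj, d, hd, rfl⟩ := hsat i hi z (by rwa [hq0])
        have hij : i ≠ j := by
          rintro rfl
          obtain rfl : d = 0 := by omega
          exact H.loopless.irrefl _ hz
        have hd1 := htriv i hi j hj d hd hq0 hij hz
        rw [Finset.mem_union, Finset.mem_image, Finset.mem_image]
        rcases (show d = 0 ∨ d = 1 by omega) with rfl | rfl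
        · exact Or.inl ⟨j, Finset.mem_erase.2 ⟨hij.symm, hmem.2 hj⟩, rfl⟩
        · exact Or.inr ⟨j, Finset.mem_filter.2 ⟨hmem.2 hj, hd, hz.symm⟩, rfl⟩
      have h₁ := (Finset.card_le_card hsub).trans (Finset.card_union_le _ _)
      have h₂ := Finset.card_image_le (s := R.erase i) (f := fun j => f j 0)
      have h₃ := Finset.card_image_le (s := R.bipartiteAbove r i) (f := fun j => f j 1)
      have h₄ : (R.erase i).card = p := by
        rw [Finset.card_erase_of_mem (hmem.2 hi), hR, Finset.card_range, Nat.add_sub_cancel]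
      omega
  have hbelow : ∀ j ∈ R, 2 * (R.bipartiteBelow r j).card ≤ if 1 ≤ q j then p else 0 := by
    intro j hj
    split_ifs with hq
    · refine le_trans (Nat.mul_le_mul_left 2 (Finset.card_le_card ?_))
        (hf.two_mul_card_spine_le hmax (hmem.1 hj) hq one_ne_zero)
      exact Finset.monotone_filter_right _ fun i _ hi => hi.2
    · rw [Nat.le_zero, Nat.mul_eq_zero, Finset.card_eq_zero]
      exact Or.inr (Finset.filter_eq_empty_iff.2 fun i _ hi => hq hi.1)
  have hsum := Finset.sum_le_sum hdeg
  rw [Finset.sum_add_distrib, ← Finset.mul_sum, ← Finset.mul_sum,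
    Finset.sum_card_bipartiteAbove_eq_sum_card_bipartiteBelow] at hsum
  have hsum' := Finset.sum_le_sum hbelow
  rw [← Finset.mul_sum] at hsum'
  have hconst : ∑ i ∈ R, (if 1 ≤ q i then p else 2 * p) + ∑ i ∈ R, (if 1 ≤ q i then p else 0) =
      (p + 1) * (2 * p) := by
    rw [← Finset.sum_add_distrib, Finset.sum_congr rfl (g := fun _ => 2 * p), Finset.sum_const,
      hR, Finset.card_range, smul_eq_mul]
    intro i _
    split_ifs <;> omega
  linarith

end IsComb

open scoped Classical in
/-- If `p` is the length of a longest path, there are `p + 1` vertices of average degree at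
most `p`, pairwise joined by long paths. -/
theorem exists_spread_vertices {W : Type*} [Fintype W] {H : SimpleGraph W} {p : ℕ} {x y : W}
    (w : H.Walk x y) (hw : w.IsPath) (hp : w.length = p)
    (hmax : ∀ T x y k, HasPathOn H T x y k → k ≤ p) :
    ∃ u : ℕ → W, (∀ i j, i < j → j ≤ p → HasPathOn H Set.univ (u i) (u j) (j - i)) ∧
      ∑ i ∈ Finset.range (p + 1), H.degree (u i) ≤ (p + 1) * p := by
  have hf : IsComb H p (fun i _ => w.getVert i) (fun _ => 0) := by
    refine ⟨fun i hi => w.adj_getVert_succ (by omega), fun i _ d hd => by omega, ?_⟩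
    intro i hi d hd j hj e he h
    exact ⟨hw.getVert_injOn (show i ≤ w.length by omega) (show j ≤ w.length by omega) h, by omega⟩
  obtain ⟨f, q, hf, hsat, htriv⟩ := hf.exists_saturated hmax
  refine ⟨fun i => f i (q i), fun i j hij hj => ?_, hf.sum_degree_tip_le hmax hsat htriv⟩
  exact (hf.path hij hj le_rfl le_rfl).mono (Set.subset_univ _) (by omega)

/-- Disjoint intervals of radius `w i + 1` around the points `2 * i` of a cycle of
length `2 * N`. -/
theorem sum_le_of_cyclic_gaps {N : ℕ} (M : Finset ℕ) (w : ℕ → ℕ)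
    (hgap : ∀ i ∈ M, ∀ j ∈ M, i < j → 2 * i + w i + w j + 2 ≤ 2 * j)
    (hwrap : ∀ i ∈ M, ∀ j ∈ M, i ≤ j → 2 * j + w i + w j + 2 ≤ 2 * (i + N)) :
    ∑ i ∈ M, (2 * w i + 2) ≤ 2 * N := by
  rcases M.eq_empty_or_nonempty with rfl | hM
  · simp
  let I : ℕ → Finset ℤ := fun i => Finset.Ico (2 * (i : ℤ) - (w i + 1)) (2 * i + (w i + 1))
  have hI : ∀ i, (I i).card = 2 * w i + 2 := by
    intro i
    rw [Int.card_Ico]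
    omega
  have hdisj : (M : Set ℕ).PairwiseDisjoint I := by
    intro i hi j hj hij
    rw [Function.onFun, Finset.disjoint_left]
    intro t ht ht'
    rw [Finset.mem_Ico] at ht ht'
    rcases lt_or_gt_of_ne hij with h | h
    · have := hgap i hi j hj h
      omega
    · have := hgap j hj i hi h
      omega
  set a := M.min' hM
  set b := M.max' hM
  have ha : a ∈ M := M.min'_mem hM
  have hb : b ∈ M := M.max'_mem hM
  have hab := hwrap a ha b hb (M.min'_le b hb)
  have hsub : M.biUnion I ⊆ Finset.Ico (2 * (a : ℤ) - (w a + 1)) (2 * b + (w b + 1)) := by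
    intro t ht
    obtain ⟨i, hi, ht⟩ := Finset.mem_biUnion.1 ht
    rw [Finset.mem_Ico] at ht ⊢
    have hl : 2 * (a : ℤ) - (w a + 1) ≤ 2 * i - (w i + 1) := by
      rcases (M.min'_le i hi).eq_or_lt with h | h
      · rw [show a = i from h]
      · have := hgap a ha i hi h
        omega
    have hr : 2 * (i : ℤ) + (w i + 1) ≤ 2 * b + (w b + 1) := by
      rcases (M.le_max' i hi).eq_or_lt with h | h
      · rw [show i = b from h]
      · have := hgap i hi b hb h
        omega
    omega
  have := Finset.card_le_card hsub
  rw [Finset.card_biUnion hdisj, Finset.sum_congr rfl fun i _ => hI i, Int.card_Ico] at this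
  omega

theorem card_add_card_le {L L' : Finset ℕ} (hL : L.Nonempty) (hL' : L'.Nonempty) {g : ℕ}
    (h : ∀ a ∈ L, ∀ b ∈ L', (b - a) + (a - b) + 2 ≤ g) : L.card + L'.card + 2 ≤ 2 * g := by
  have hcard : ∀ {L : Finset ℕ} (hL : L.Nonempty), L.card ≤ L.max' hL + 1 - L.min' hL := by
    intro L hL
    rw [← Nat.card_Icc]
    exact Finset.card_le_card fun a ha => Finset.mem_Icc.2 ⟨L.min'_le a ha, L.le_max' a ha⟩
  have h₁ := h _ (L.min'_mem hL) _ (L'.max'_mem hL')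
  have h₂ := h _ (L.max'_mem hL) _ (L'.min'_mem hL')
  have h₃ := hcard hL
  have h₄ := hcard hL'
  have h₅ := L.min'_le _ (L.max'_mem hL)
  have h₆ := L'.min'_le _ (L'.max'_mem hL')
  omega

open scoped Classical in
/-- A longest cycle `c` (given as an `N`-periodic sequence) is long if many vertices off the
cycle, pairwise joined by long paths off the cycle, have many neighbours on it. -/
theorem mul_le_longest_cycle {V : Type*} {G : SimpleGraph V} {N p D : ℕ} {c u : ℕ → V}
    (hN : 2 ≤ N) (hadj : ∀ i, G.Adj (c i) (c (i + 1)))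
    (hinj : ∀ i j, i < j → j < i + N → c i ≠ c j) (hper : ∀ i, c (i + N) = c i)
    (hlong : ∀ (x : V) (E : G.Walk x x), E.IsCycle → E.length ≤ N)
    (hoff : ∀ a ≤ p, u a ∉ Set.range c)
    (hu : ∀ a b, a < b → b ≤ p → HasPathOn G (Set.range c)ᶜ (u a) (u b) (b - a))
    (hD : (p + 1) * D ≤
      ∑ a ∈ Finset.range (p + 1), ((Finset.range N).filter fun i => G.Adj (u a) (c i)).card) :
    (p + 2) * D ≤ N := by
  have hu' : ∀ a ≤ p, ∀ b ≤ p, HasPathOn G (Set.range c)ᶜ (u a) (u b) ((b - a) + (a - b)) := by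
    intro a ha b hb
    rcases lt_trichotomy a b with h | rfl | h
    · exact (hu a b h hb).mono subset_rfl (by omega)
    · exact (HasPathOn.single (T := (Set.range c)ᶜ) (hoff a ha)).mono subset_rfl (by omega)
    · exact (hu b a h ha).symm.mono subset_rfl (by omega)
  have hgap : ∀ i j, i < j → j ≤ i + N → ∀ a ≤ p, ∀ b ≤ p, G.Adj (u a) (c i) →
      G.Adj (u b) (c j) → (b - a) + (a - b) + 2 ≤ j - i := by
    intro i j hij hjN a ha b hb hai hbj
    have harc := HasPathOn.of_seq (G := G) (c := c) hjN (fun k _ _ => hadj k)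
      (fun k l hk hkl hl => hinj k l hkl (by omega))
    rw [hper] at harc
    have hpath := harc.join (hu' a ha b hb) hai.symm (by
      rw [Set.disjoint_left]
      rintro _ ⟨k, -, -, rfl⟩ hk
      exact hk ⟨k, rfl⟩)
    by_cases h2 : 2 ≤ i + N - j + ((b - a) + (a - b)) + 1
    · obtain ⟨x, E, hE, hlen⟩ := hpath.exists_isCycle h2 hbj
      have := hlong x E hE
      omega
    · omega
  let r : ℕ → ℕ → Prop := fun a i => G.Adj (u a) (c i)
  let L : ℕ → Finset ℕ := fun i => (Finset.range (p + 1)).bipartiteBelow r i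
  let M := (Finset.range N).filter fun i => (L i).Nonempty
  have hL : ∀ {i a}, a ∈ L i → a ≤ p ∧ G.Adj (u a) (c i) := by
    intro i a ha
    have := Finset.mem_filter.1 ha
    exact ⟨Nat.le_of_lt_succ (Finset.mem_range.1 this.1), this.2⟩
  have hM : ∀ {i}, i ∈ M → i < N ∧ (L i).Nonempty := by
    intro i hi
    have := Finset.mem_filter.1 hi
    exact ⟨Finset.mem_range.1 this.1, this.2⟩
  have hweights : ∑ i ∈ M, (2 * (L i).card + 2) ≤ 2 * N := by
    refine sum_le_of_cyclic_gaps M _ ?_ ?_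
    · intro i hi j hj hij
      have := hM hj
      have := card_add_card_le (hM hi).2 (hM hj).2 fun a ha b hb =>
        hgap i j hij (by omega) a (hL ha).1 b (hL hb).1 (hL ha).2 (hL hb).2
      omega
    · intro i hi j hj hij
      have := hM hj
      have := card_add_card_le (hM hj).2 (hM hi).2 fun a ha b hb =>
        hgap j (i + N) (by omega) (by omega) a (hL ha).1 b (hL hb).1 (hL ha).2
          (by rw [hper]; exact (hL hb).2)
      omega
  have hsum : ∑ i ∈ M, (L i).card = ∑ i ∈ Finset.range N, (L i).card := by
    refine Finset.sum_filter_of_ne fun i _ hi => ?_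
    exact Finset.card_pos.1 (Nat.pos_of_ne_zero hi)
  rw [Finset.sum_add_distrib, ← Finset.mul_sum, hsum,
    ← Finset.sum_card_bipartiteAbove_eq_sum_card_bipartiteBelow, Finset.sum_const,
    smul_eq_mul] at hweights
  have hZ : ∀ a ∈ Finset.range (p + 1), ((Finset.range N).bipartiteAbove r a).card ≤ M.card := by
    intro a ha
    refine Finset.card_le_card fun i hi => ?_
    have hi := Finset.mem_filter.1 hi
    exact Finset.mem_filter.2 ⟨hi.1, a, Finset.mem_filter.2 ⟨ha, hi.2⟩⟩
  have hcard := Finset.sum_le_card_nsmul _ _ _ hZ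
  rw [Finset.card_range, smul_eq_mul] at hcard
  change (p + 1) * D ≤ ∑ a ∈ Finset.range (p + 1), ((Finset.range N).bipartiteAbove r a).card at hD
  have hDM : D ≤ M.card := Nat.le_of_mul_le_mul_left (hD.trans hcard) (Nat.succ_pos p)
  linarith

/-- A longest cycle `C` has length at least `(p + 2) * (δ - p)`, where `p` is the length of a
longest path off `C`. -/
theorem IsLongestCycle.mul_le_length {V : Type*} [Fintype V] (G : SimpleGraph V)
    [DecidableRel G.Adj] {v : V} {C : G.Walk v v} (hC : IsLongestCycle G C) {p : ℕ}
    {x y : {x : V | x ∉ C.support}} (w : (G.induce {x : V | x ∉ C.support}).Walk x y)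
    (hw : w.IsPath) (hp : w.length = p)
    (hmax : ∀ T x y k, HasPathOn (G.induce {x : V | x ∉ C.support}) T x y k → k ≤ p) :
    (p + 2) * (G.minDegree - p) ≤ C.length ∧ C.length + p + 1 ≤ Fintype.card V := by
  classical
  obtain ⟨u, hu, hdeg⟩ := exists_spread_vertices w hw hp hmax
  set N := C.length with hNdef
  have hN : 3 ≤ N := hC.1.three_le_length
  let c : ℕ → V := fun i => C.getVert (i % N)
  have hclt : ∀ i < N, c i = C.getVert i := fun i hi => by simp only [c, Nat.mod_eq_of_lt hi]
  have hmem : ∀ z, z ∈ C.support ↔ ∃ i < N, c i = z := by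
    intro z
    rw [Walk.mem_support_iff_exists_getVert]
    constructor
    · rintro ⟨i, hi, hiN⟩
      rcases hiN.eq_or_lt with rfl | hlt
      · refine ⟨0, by omega, ?_⟩
        rw [hclt 0 (by omega), Walk.getVert_zero, ← hi, Walk.getVert_length]
      · exact ⟨i, hlt, by rw [hclt i hlt, hi]⟩
    · rintro ⟨i, hi, h⟩
      exact ⟨i, by rw [← hclt i hi, h], hi.le⟩
  have hinjN : ∀ i < N, ∀ j < N, c i = c j → i = j := by
    intro i hi j hj h
    rw [hclt i hi, hclt j hj] at h
    exact hC.1.getVert_injOn' (show i ≤ C.length - 1 by omega)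
      (show j ≤ C.length - 1 by omega) h
  have hrange : (Set.range c) = {z | z ∈ C.support} := by
    ext z
    rw [Set.mem_ofPred_eq, hmem]
    constructor
    · rintro ⟨i, rfl⟩
      exact ⟨i % N, Nat.mod_lt _ (by omega), by simp only [c, Nat.mod_mod]⟩
    · rintro ⟨i, -, rfl⟩
      exact ⟨i, rfl⟩
  constructor
  · refine mul_le_longest_cycle (c := c) (u := fun a => (u a : V)) (by omega) ?_ ?_ ?_ hC.2 ?_ ?_ ?_
    · intro i
      have hi : i % N < N := Nat.mod_lt _ (by omega)
      have := C.adj_getVert_succ hi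
      by_cases h : i % N + 1 = N
      · have h0 : (i + 1) % N = 0 := by
          rw [Nat.add_mod, Nat.mod_eq_of_lt (by omega : 1 < N), h, Nat.mod_self]
        rw [h, Walk.getVert_length] at this
        simpa only [c, h0, Walk.getVert_zero] using this
      · have h1 : (i + 1) % N = i % N + 1 := by
          rw [Nat.add_mod, Nat.mod_eq_of_lt (by omega : 1 < N), Nat.mod_eq_of_lt (by omega)]
        simpa only [c, h1] using this
    · intro i j hij hj h
      have h' := hinjN (i % N) (Nat.mod_lt _ (by omega)) (j % N) (Nat.mod_lt _ (by omega))
        (by simpa only [c, Nat.mod_mod] using h)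
      have := (Nat.modEq_iff_dvd' hij.le).1 h'
      have := Nat.le_of_dvd (by omega) this
      omega
    · intro i
      simp only [c, Nat.add_mod_right]
    · intro a _
      rw [hrange]
      exact (u a).2
    · intro a b hab hb
      refine ((hu a b hab hb).map (Embedding.induce _)).mono ?_ le_rfl
      rintro _ ⟨z, -, rfl⟩
      rw [hrange]
      exact z.2
    · have hone : ∀ a ∈ Finset.range (p + 1), G.minDegree ≤
          ((Finset.range N).filter fun i => G.Adj (u a) (c i)).card +
            (G.induce {x : V | x ∉ C.support}).degree (u a) := by
        intro a _
        refine (G.minDegree_le_degree (u a)).trans ?_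
        rw [← card_neighborFinset_eq_degree, ← card_neighborFinset_eq_degree]
        have hsub : G.neighborFinset (u a) ⊆
            (((Finset.range N).filter fun i => G.Adj (u a) (c i)).image c) ∪
              ((G.induce {x : V | x ∉ C.support}).neighborFinset (u a)).image Subtype.val := by
          intro z hz
          rw [mem_neighborFinset] at hz
          rw [Finset.mem_union]
          by_cases hzC : z ∈ C.support
          · obtain ⟨i, hi, rfl⟩ := (hmem z).1 hzC
            exact Or.inl (Finset.mem_image_of_mem _
              (Finset.mem_filter.2 ⟨Finset.mem_range.2 hi, hz⟩))
          · refine Or.inr (Finset.mem_image.2 ⟨⟨z, hzC⟩, ?_, rfl⟩)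
            rw [mem_neighborFinset]
            exact hz
        exact ((Finset.card_le_card hsub).trans (Finset.card_union_le _ _)).trans
          (Nat.add_le_add Finset.card_image_le Finset.card_image_le)
      have hsum := Finset.sum_le_sum hone
      rw [Finset.sum_add_distrib, Finset.sum_const, Finset.card_range, smul_eq_mul] at hsum
      rw [Nat.mul_sub, Nat.sub_le_iff_le_add]
      refine hsum.trans (Nat.add_le_add (le_of_eq ?_) (le_trans (le_of_eq ?_) hdeg))
      · exact Finset.sum_congr rfl fun a _ => by congr!
      · exact Finset.sum_congr rfl fun a _ => by congr!
  · have h₁ : ((Finset.range N).image c).card = N := by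
      rw [Finset.card_image_of_injOn, Finset.card_range]
      intro i hi j hj h
      exact hinjN i (by simpa using hi) j (by simpa using hj) h
    have h₂ : (w.support.toFinset.image Subtype.val).card = p + 1 := by
      rw [Finset.card_image_of_injective _ Subtype.val_injective,
        List.toFinset_card_of_nodup hw.support_nodup, Walk.length_support, hp]
    have hd : Disjoint ((Finset.range N).image c) (w.support.toFinset.image Subtype.val) := by
      rw [Finset.disjoint_left]
      intro z hz hz'
      obtain ⟨i, hi, rfl⟩ := Finset.mem_image.1 hz
      obtain ⟨z, -, h⟩ := Finset.mem_image.1 hz'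
      exact z.2 ((hmem z).2 ⟨i, Finset.mem_range.1 hi, h.symm⟩)
    have := Finset.card_le_univ ((Finset.range N).image c ∪ w.support.toFinset.image Subtype.val)
    rw [Finset.card_union_of_disjoint hd, h₁, h₂] at this
    omega

theorem exists_isPath_length_eq_pbar {W : Type*} [Fintype W] [Nonempty W] (H : SimpleGraph W) :
    ∃ (p : ℕ) (x y : W) (w : H.Walk x y), pbar H = p ∧ w.IsPath ∧ w.length = p ∧
      ∀ T x y k, HasPathOn H T x y k → k ≤ p := by
  set S := {n : ℕ | ∃ (u v : W) (p : H.Walk u v), p.IsPath ∧ p.length = n} with hS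
  have hbdd : BddAbove S := by
    refine ⟨Fintype.card W, ?_⟩
    rintro n ⟨u, v, p, hp, rfl⟩
    exact hp.length_lt.le
  have hne : S.Nonempty := ⟨0, Classical.arbitrary W, _, Walk.nil, Walk.IsPath.nil, rfl⟩
  obtain ⟨x, y, w, hw, hlen⟩ := Nat.sSup_mem hne hbdd
  refine ⟨sSup S, x, y, w, ?_, hw, hlen, ?_⟩
  · rw [pbar, if_pos ‹Nonempty W›]
  · rintro T x y k ⟨w', hw', -, hk⟩
    exact hk.trans (le_csSup hbdd ⟨x, y, w', hw', rfl⟩)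

theorem SimpleGraph.Walk.IsCycle.exists_notMem_support {V : Type*} [Fintype V] [DecidableEq V]
    {G : SimpleGraph V} {v : V} {C : G.Walk v v} (hC : C.IsCycle)
    (hnotHam : ¬ C.IsHamiltonianCycle) : ∃ x, x ∉ C.support := by
  by_contra! h
  refine hnotHam (Walk.isHamiltonianCycle_iff_isCycle_and_support_count_tail_eq_one.2
    ⟨hC, fun a => List.count_eq_one_of_mem hC.support_nodup ?_⟩)
  have ha := h a
  rw [← Walk.cons_tail_support, List.mem_cons] at ha
  rcases ha with rfl | ha
  · exact Walk.end_mem_tail_support hC.not_nil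
  · exact ha

/-- If a longest cycle `C` is not a Hamilton cycle and `δ ≥ (n+2)/(l+1) + l - 2`,
then `(l - p̄ - 1)(δ - l - p̄) ≥ 1`. -/
theorem stmt_6 {V : Type*} [Fintype V] [DecidableEq V] (G : SimpleGraph V)
    [DecidableRel G.Adj] (l : ℕ) (hl : 1 ≤ l)
    {v : V} (C : G.Walk v v) (hC : IsLongestCycle G C)
    (hnotHam : ¬ C.IsHamiltonianCycle)
    (hdeg : (G.minDegree : ℝ) ≥ ((Fintype.card V : ℝ) + 2) / ((l : ℝ) + 1) + (l : ℝ) - 2) :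
    ((l : ℤ) - pbar (G.induce {x : V | x ∉ C.support}) - 1) *
      ((G.minDegree : ℤ) - (l : ℤ) - pbar (G.induce {x : V | x ∉ C.support})) ≥ 1 := by
  obtain ⟨x₀, hx₀⟩ := hC.1.exists_notMem_support hnotHam
  have : Nonempty {x : V | x ∉ C.support} := ⟨⟨x₀, hx₀⟩⟩
  obtain ⟨p, x, y, w, hpbar, hw, hlen, hmax⟩ :=
    exists_isPath_length_eq_pbar (G.induce {x : V | x ∉ C.support})
  obtain ⟨hlong, hcard⟩ := hC.mul_le_length G w hw hlen hmax
  rw [hpbar]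
  have hdeg' : (Fintype.card V : ℤ) + 2 ≤ (G.minDegree - l + 2) * (l + 1) := by
    have : ((Fintype.card V : ℝ) + 2) / (l + 1) ≤ G.minDegree - l + 2 := by linarith
    rw [div_le_iff₀ (by positivity)] at this
    exact_mod_cast this
  have hlong' : ((p : ℤ) + 2) * (G.minDegree - p) ≤ C.length := by
    calc ((p : ℤ) + 2) * (G.minDegree - p) ≤ (p + 2) * ((G.minDegree - p : ℕ) : ℤ) :=
          mul_le_mul_of_nonneg_left (by omega) (by positivity)
      _ ≤ C.length := by exact_mod_cast hlong
  have hcard' : (C.length : ℤ) + p + 1 ≤ Fintype.card V := by exact_mod_cast hcard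
  linarith
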